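/- For every multi-index length m there is a constant C such that for every w ∈ C_0^∞(ℝ_+×ℝ³), every product Γ^α of |α| ≤ m vector fields from Γ, and every t ≥ 0: ‖⟨t−r⟩ ∂_{t,x}² Γ^α w(t,·)‖_{L²(ℝ³)} ≤ C Σ_{|β|≤|α|+1} ‖Γ^β ∂w(t,·)‖_{L²(ℝ³)} + C Σ_{|β|≤|α|} ‖⟨t+r⟩ □Γ^β w(t,·)‖_{L²(ℝ³)}, where ∂_{t,x}² denotes the collection of all second-order t,x-derivatives. -/

import Mathlib

open MeasureTheory

noncomputable section

/-- The partial derivative in the `i`-th coordinate direction on `ℝⁿ`. -/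
def pd {n : ℕ} (i : Fin n) (u : (Fin n → ℝ) → ℝ) : (Fin n → ℝ) → ℝ :=
  fun z => fderiv ℝ u z (Pi.single i 1)

/-- Iterated application of a family of first-order operators along a list of indices. -/
def opIter {α γ : Type*} (F : α → γ → γ) : List α → γ → γ
  | [] => id
  | i :: L => fun u => F i (opIter F L u)

/-- The ten vector fields Γ on ℝ×ℝ³ (coordinates: `0 = t`, `1,2,3 = x`):
`∂_t, ∂_{x₁}, ∂_{x₂}, ∂_{x₃}`, the rotations `Ω_{jk} = x_j∂_k - x_k∂_j` (`1 ≤ j < k ≤ 3`)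
and the boosts `Ω_{0k} = x_k∂_t + t∂_k` (`k = 1,2,3`). -/
def GammaField (i : Fin 10) (u : (Fin 4 → ℝ) → ℝ) : (Fin 4 → ℝ) → ℝ :=
  if i.val = 0 then pd 0 u
  else if i.val = 1 then pd 1 u
  else if i.val = 2 then pd 2 u
  else if i.val = 3 then pd 3 u
  else if i.val = 4 then fun z => z 1 * pd 2 u z - z 2 * pd 1 u z
  else if i.val = 5 then fun z => z 1 * pd 3 u z - z 3 * pd 1 u z
  else if i.val = 6 then fun z => z 2 * pd 3 u z - z 3 * pd 2 u z
  else if i.val = 7 then fun z => z 1 * pd 0 u z + z 0 * pd 1 u z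
  else if i.val = 8 then fun z => z 2 * pd 0 u z + z 0 * pd 2 u z
  else fun z => z 3 * pd 0 u z + z 0 * pd 3 u z

/-- The spatial radius `r = |x|` of a space-time point. -/
def rad (z : Fin 4 → ℝ) : ℝ := Real.sqrt ((z 1)^2 + (z 2)^2 + (z 3)^2)

/-- The d'Alembertian `□ = ∂_t² - Δ` on ℝ×ℝ³. -/
def Box (u : (Fin 4 → ℝ) → ℝ) : (Fin 4 → ℝ) → ℝ :=
  fun z => pd 0 (pd 0 u) z - pd 1 (pd 1 u) z - pd 2 (pd 2 u) z - pd 3 (pd 3 u) z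

/-- The `L²` norm in `x ∈ ℝ³` at fixed time `t`. -/
def L2x (f : (Fin 4 → ℝ) → ℝ) (t : ℝ) : ℝ :=
  Real.sqrt (∫ x : Fin 3 → ℝ, (f (Fin.cons t x))^2)

lemma abs_sum_fin_three_le {f : Fin 3 → ℝ} {A : ℝ} (h : ∀ k, |f k| ≤ A) : |∑ k, f k| ≤ 3 * A := by
  refine (Finset.abs_sum_le_sum_abs _ _).trans ((Finset.sum_le_sum fun k _ => h k).trans ?_)
  simp

lemma abs_mul_le_of_abs_le_one {a b A : ℝ} (ha : |a| ≤ 1) (hb : |b| ≤ A) : |a * b| ≤ A := by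
  rw [abs_mul]
  nlinarith [abs_nonneg a, abs_nonneg b]

lemma abs_le_one_of_sum_sq_le_one {v : Fin 3 → ℝ} (hv : ∑ k, v k ^ 2 ≤ 1) (k : Fin 3) :
    |v k| ≤ 1 := by
  have := Finset.single_le_sum (f := fun k => v k ^ 2) (fun i _ => sq_nonneg _) (Finset.mem_univ k)
  exact abs_le_one_iff_mul_self_le_one.2 (by nlinarith)

/-- Inside the light cone, the boosts and the trace control the Hessian; normalized to `t = 1`. -/
lemma hessian_bound_inside {h : Fin 4 → Fin 4 → ℝ} (hsymm : ∀ i j, h i j = h j i)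
    {v : Fin 3 → ℝ} {ρ A : ℝ} (hρ : 0 ≤ ρ) (hρ' : ρ ≤ 1) (hv : ∑ k, v k ^ 2 = ρ ^ 2)
    (hboost : ∀ k i, |v k * h 0 i + h k.succ i| ≤ A) (i j : Fin 4) :
    (1 - ρ) * |h i j| ≤ 33 * A + |h 0 0 - ∑ k : Fin 3, h k.succ k.succ| := by
  set b : Fin 3 → Fin 4 → ℝ := fun k i => v k * h 0 i + h k.succ i with hb
  set D := h 0 0 - ∑ k : Fin 3, h k.succ k.succ with hD
  have hv1 : ∀ k, |v k| ≤ 1 := abs_le_one_of_sum_sq_le_one (by rw [hv]; nlinarith)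
  have hA : 0 ≤ A := (abs_nonneg _).trans (hboost 0 0)
  have key : (1 - ρ ^ 2) * h 0 0 = D + ∑ k, b k k.succ - ∑ k, v k * b k 0 := by
    have h1 := hsymm 1 0
    have h2 := hsymm 2 0
    have h3 := hsymm 3 0
    simp only [Fin.sum_univ_three, Fin.isValue, Fin.succ_zero_eq_one, Fin.succ_one_eq_two,
      show Fin.succ (2 : Fin 3) = 3 from rfl, hb, hD] at hv ⊢
    linear_combination (h 0 0) * hv + v 0 * h1 + v 1 * h2 + v 2 * h3
  have hb1 : |∑ k, b k k.succ| ≤ 3 * A := abs_sum_fin_three_le fun k => hboost k _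
  have hb2 : |∑ k, v k * b k 0| ≤ 3 * A :=
    abs_sum_fin_three_le fun k => abs_mul_le_of_abs_le_one (hv1 k) (hboost k _)
  have h00 : |(1 - ρ) * h 0 0| ≤ 6 * A + |D| := by
    have : |(1 - ρ ^ 2) * h 0 0| ≤ 6 * A + |D| := by
      rw [key, abs_le]
      constructor <;> linarith [abs_le.1 hb1, abs_le.1 hb2, le_abs_self D, neg_abs_le D]
    rw [abs_mul, abs_of_nonneg (by nlinarith)] at this ⊢
    nlinarith [mul_nonneg (mul_nonneg (sub_nonneg.2 hρ') hρ) (abs_nonneg (h 0 0))]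
  have step : ∀ (k : Fin 3) (i : Fin 4) (M : ℝ), |(1 - ρ) * h 0 i| ≤ M →
      |(1 - ρ) * h k.succ i| ≤ A + M := by
    intro k i M hM
    have e : (1 - ρ) * h k.succ i = (1 - ρ) * b k i - v k * ((1 - ρ) * h 0 i) := by
      simp only [hb]; ring
    rw [e]
    refine (abs_sub _ _).trans (add_le_add ?_ (abs_mul_le_of_abs_le_one (hv1 k) hM))
    exact abs_mul_le_of_abs_le_one (abs_le.2 ⟨by linarith, by linarith⟩) (hboost k i)
  have h0 : ∀ i, |(1 - ρ) * h 0 i| ≤ 7 * A + |D| := by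
    intro i
    refine Fin.cases (by linarith) (fun k => ?_) i
    rw [hsymm]
    linarith [step k 0 _ h00]
  rw [← abs_of_nonneg (sub_nonneg.2 hρ'), ← abs_mul]
  refine Fin.cases (by linarith [h0 j]) (fun k => ?_) i
  linarith [step k j _ (h0 j)]

/-- Outside the light cone, the boosts, the rotations and the trace control the Hessian;
normalized to `r = 1`. -/
lemma hessian_bound_outside {h : Fin 4 → Fin 4 → ℝ} (hsymm : ∀ i j, h i j = h j i)
    {v : Fin 3 → ℝ} {s A : ℝ} (hs : 0 ≤ s) (hs' : s ≤ 1) (hv : ∑ k, v k ^ 2 = 1)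
    (hboost : ∀ k i, |v k * h 0 i + s * h k.succ i| ≤ A)
    (hrot : ∀ j k i, |v j * h (Fin.succ k) i - v k * h (Fin.succ j) i| ≤ A) (i j : Fin 4) :
    (1 - s) * |h i j| ≤ 33 * A + |h 0 0 - ∑ k : Fin 3, h k.succ k.succ| := by
  set b : Fin 3 → Fin 4 → ℝ := fun k i => v k * h 0 i + s * h k.succ i with hb
  set R : Fin 3 → Fin 3 → Fin 4 → ℝ :=
    fun j k i => v j * h (Fin.succ k) i - v k * h (Fin.succ j) i with hR
  set D := h 0 0 - ∑ k : Fin 3, h k.succ k.succ with hD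
  set e : Fin 3 → Fin 4 → ℝ := fun k i => ∑ j, v j * R j k i with he
  set p : Fin 4 → ℝ := fun i => ∑ j : Fin 3, v j * h j.succ i with hp
  set q : ℝ := ∑ k : Fin 3, v k * p k.succ with hq
  have hv1 : ∀ k, |v k| ≤ 1 := abs_le_one_of_sum_sq_le_one hv.le
  have hA : 0 ≤ A := (abs_nonneg _).trans (hboost 0 0)
  have hs1 : |s| ≤ 1 := abs_le.2 ⟨by linarith, hs'⟩
  have h1s : |1 - s| ≤ 1 := abs_le.2 ⟨by linarith, by linarith⟩
  have hv3 : v 0 ^ 2 + v 1 ^ 2 + v 2 ^ 2 = 1 := by rw [← hv, Fin.sum_univ_three]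
  have spatial : ∀ k i, h (Fin.succ k) i = v k * p i + e k i := by
    intro k i
    simp only [he, hp, hR, Fin.sum_univ_three]
    linear_combination (-h k.succ i) * hv3
  have temporal : ∀ i, h 0 i = ∑ k, v k * b k i - s * p i := by
    intro i
    simp only [hb, hp, Fin.sum_univ_three]
    linear_combination (-h 0 i) * hv3
  have radial0 : p 0 = ∑ j : Fin 3, v j * (∑ k, v k * b k j.succ) - s * q := by
    have : p 0 = ∑ j : Fin 3, v j * h 0 j.succ := by
      simp only [hp]
      exact Finset.sum_congr rfl fun j _ => by rw [hsymm]
    rw [this]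
    simp only [temporal, hq, Fin.sum_univ_three]
    ring
  have radial : ∀ j : Fin 3, p j.succ = v j * q + ∑ k : Fin 3, v k * e j k.succ := by
    intro j
    have : p j.succ = ∑ k : Fin 3, v k * h j.succ k.succ := by
      simp only [hp]
      exact Finset.sum_congr rfl fun k _ => by rw [hsymm]
    rw [this]
    simp only [spatial, hq, Fin.sum_univ_three]
    ring
  have trace : q = h 0 0 - D - ∑ k : Fin 3, e k k.succ := by
    simp only [hD, spatial _ (Fin.succ _), hq, Fin.sum_univ_three]
    ring
  have key : (1 - s ^ 2) * q = ∑ k, v k * b k 0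
      - s * ∑ j : Fin 3, v j * (∑ k, v k * b k j.succ) - D - ∑ k : Fin 3, e k k.succ := by
    have t0 := temporal 0
    rw [radial0] at t0
    linear_combination trace + t0
  have be : ∀ k i, |e k i| ≤ 3 * A := fun k i =>
    abs_sum_fin_three_le fun j => abs_mul_le_of_abs_le_one (hv1 j) (hrot j k i)
  have bb : ∀ i, |∑ k, v k * b k i| ≤ 3 * A := fun i =>
    abs_sum_fin_three_le fun k => abs_mul_le_of_abs_le_one (hv1 k) (hboost k i)
  have bbb : |∑ j : Fin 3, v j * (∑ k, v k * b k j.succ)| ≤ 3 * (3 * A) :=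
    abs_sum_fin_three_le fun j => abs_mul_le_of_abs_le_one (hv1 j) (bb _)
  have bE : |∑ k : Fin 3, e k k.succ| ≤ 3 * (3 * A) := abs_sum_fin_three_le fun k => be _ _
  have bq : |(1 - s) * q| ≤ 21 * A + |D| := by
    have : |(1 - s ^ 2) * q| ≤ 21 * A + |D| := by
      rw [key, abs_le]
      have := abs_le.1 (abs_mul_le_of_abs_le_one hs1 bbb)
      constructor <;> linarith [abs_le.1 (bb 0), abs_le.1 bE, le_abs_self D, neg_abs_le D]
    rw [abs_mul, abs_of_nonneg (by nlinarith)] at this ⊢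
    nlinarith [mul_nonneg (mul_nonneg (sub_nonneg.2 hs') hs) (abs_nonneg q)]
  have bp : ∀ i, |(1 - s) * p i| ≤ 30 * A + |D| := by
    intro i
    refine Fin.cases ?_ (fun j => ?_) i
    · rw [radial0, mul_sub, mul_left_comm (1 - s) s]
      refine (abs_sub _ _).trans ?_
      linarith [abs_mul_le_of_abs_le_one h1s bbb, abs_mul_le_of_abs_le_one hs1 bq]
    · rw [radial, mul_add, mul_left_comm (1 - s) (v j)]
      refine (abs_add_le _ _).trans ?_
      have : |∑ k : Fin 3, v k * e j k.succ| ≤ 3 * (3 * A) :=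
        abs_sum_fin_three_le fun k => abs_mul_le_of_abs_le_one (hv1 k) (be _ _)
      linarith [abs_mul_le_of_abs_le_one h1s this, abs_mul_le_of_abs_le_one (hv1 j) bq]
  rw [← abs_of_nonneg (sub_nonneg.2 hs'), ← abs_mul]
  refine Fin.cases ?_ (fun k => ?_) i
  · rw [temporal, mul_sub, mul_left_comm (1 - s) s]
    refine (abs_sub _ _).trans ?_
    linarith [abs_mul_le_of_abs_le_one h1s (bb j), abs_mul_le_of_abs_le_one hs1 (bp j)]
  · rw [spatial, mul_add, mul_left_comm (1 - s) (v k)]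
    refine (abs_add_le _ _).trans ?_
    linarith [abs_mul_le_of_abs_le_one h1s (be k j), abs_mul_le_of_abs_le_one (hv1 k) (bp j)]

/-- The pointwise Klainerman–Sideris inequality for a symmetric matrix `H`, in terms of the
contractions of `H` with the boosts and the rotations and of its Minkowski trace. -/
lemma hessian_bound {H : Fin 4 → Fin 4 → ℝ} (hsymm : ∀ i j, H i j = H j i)
    {x : Fin 3 → ℝ} {t r A : ℝ} (ht : 0 ≤ t) (hr : 0 ≤ r) (hx : ∑ k, x k ^ 2 = r ^ 2)
    (hboost : ∀ k i, |x k * H 0 i + t * H k.succ i| ≤ A)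
    (hrot : ∀ j k i, |x j * H (Fin.succ k) i - x k * H (Fin.succ j) i| ≤ A) (i j : Fin 4) :
    |t - r| * |H i j| ≤ 33 * A + (t + r) * |H 0 0 - ∑ k : Fin 3, H k.succ k.succ| := by
  have hA : 0 ≤ A := (abs_nonneg _).trans (hboost 0 0)
  rcases eq_or_ne t r with rfl | hne
  · rw [sub_self, abs_zero, zero_mul]
    positivity
  rcases lt_or_gt_of_ne hne with hlt | hlt
  · have hr0 : 0 < r := ht.trans_lt hlt
    have := hessian_bound_outside (h := fun i j => r * H i j) (v := fun k => x k / r)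
      (s := t / r) (A := A) (fun i j => by rw [hsymm]) (by positivity) ((div_le_one hr0).2 hlt.le)
      (by simp only [div_pow, ← Finset.sum_div, hx]; field_simp)
      (fun k i => by
        convert hboost k i using 2
        field_simp)
      (fun j k i => by
        convert hrot j k i using 2
        field_simp) i j
    simp only [← Finset.mul_sum, ← mul_sub, abs_mul r, abs_of_pos hr0] at this
    rw [abs_of_neg (sub_neg.2 hlt)]
    have e : (1 - t / r) * (r * |H i j|) = -(t - r) * |H i j| := by field_simp; ring
    rw [e] at this
    linarith [mul_nonneg ht (abs_nonneg (H 0 0 - ∑ k : Fin 3, H k.succ k.succ))]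
  · have ht0 : 0 < t := hr.trans_lt hlt
    have := hessian_bound_inside (h := fun i j => t * H i j) (v := fun k => x k / t)
      (ρ := r / t) (A := A) (fun i j => by rw [hsymm]) (by positivity) ((div_le_one ht0).2 hlt.le)
      (by simp only [div_pow, ← Finset.sum_div, hx])
      (fun k i => by
        convert hboost k i using 2
        field_simp) i j
    simp only [← Finset.mul_sum, ← mul_sub, abs_mul t, abs_of_pos ht0] at this
    rw [abs_of_pos (sub_pos.2 hlt)]
    have e : (1 - r / t) * (t * |H i j|) = (t - r) * |H i j| := by field_simp
    rw [e] at this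
    linarith [mul_nonneg hr (abs_nonneg (H 0 0 - ∑ k : Fin 3, H k.succ k.succ))]

protected lemma ContDiff.pd {n : ℕ} {u : (Fin n → ℝ) → ℝ} (hu : ContDiff ℝ (⊤ : ℕ∞) u) (i : Fin n) :
    ContDiff ℝ (⊤ : ℕ∞) (pd i u) :=
  (hu.fderiv_right (by simp)).clm_apply contDiff_const

protected lemma HasCompactSupport.pd {n : ℕ} {u : (Fin n → ℝ) → ℝ} (hu : HasCompactSupport u) (i : Fin n) :
    HasCompactSupport (pd i u) :=
  hu.fderiv_apply ℝ _

lemma pd_comm {n : ℕ} {u : (Fin n → ℝ) → ℝ} (hu : ContDiff ℝ (⊤ : ℕ∞) u) (i j : Fin n) :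
    pd i (pd j u) = pd j (pd i u) := by
  funext z
  have hd : DifferentiableAt ℝ (fderiv ℝ u) z :=
    ((hu.fderiv_right (m := 1) (WithTop.coe_le_coe.2 le_top)).differentiable (by simp)) z
  have key : ∀ a b : Fin n, pd a (pd b u) z
      = fderiv ℝ (fderiv ℝ u) z (Pi.single a 1) (Pi.single b 1) := by
    intro a b
    unfold pd
    rw [fderiv_clm_apply hd (by fun_prop)]
    simp
  rw [key, key]
  exact (hu.contDiffAt.isSymmSndFDerivAt (by simp; exact WithTop.coe_le_coe.2 le_top)) _ _

lemma pd_add {n : ℕ} {u v : (Fin n → ℝ) → ℝ} (hu : ContDiff ℝ (⊤ : ℕ∞) u)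
    (hv : ContDiff ℝ (⊤ : ℕ∞) v) (i : Fin n) :
    pd i (fun z => u z + v z) = fun z => pd i u z + pd i v z := by
  funext z
  unfold pd
  rw [fderiv_fun_add (hu.differentiable (by simp) z) (hv.differentiable (by simp) z)]
  simp

lemma pd_const_mul {n : ℕ} {u : (Fin n → ℝ) → ℝ} (hu : ContDiff ℝ (⊤ : ℕ∞) u) (c : ℝ)
    (i : Fin n) : pd i (fun z => c * u z) = fun z => c * pd i u z := by
  funext z
  unfold pd
  rw [fderiv_const_mul (hu.differentiable (by simp) z)]
  simp

lemma pd_coord_mul {n : ℕ} {u : (Fin n → ℝ) → ℝ} (hu : ContDiff ℝ (⊤ : ℕ∞) u) (a i : Fin n) :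
    pd i (fun z => z a * u z) =
      fun z => z a * pd i u z + (Pi.single i (1 : ℝ) : Fin n → ℝ) a * u z := by
  funext z
  unfold pd
  rw [fderiv_fun_mul (by fun_prop) (hu.differentiable (by simp) z)]
  have : fderiv ℝ (fun z : Fin n → ℝ => z a) z = ContinuousLinearMap.proj a :=
    (ContinuousLinearMap.proj (R := ℝ) (φ := fun _ : Fin n => ℝ) a).fderiv
  rw [this]
  simp [mul_comm]

/-- Each vector field is a coordinate derivative or a (Euclidean or Lorentzian) rotation. -/
lemma GammaField_eq (i : Fin 10) :
    (∃ a, GammaField i = pd a) ∨ ∃ a b : Fin 4, ∃ ε : ℝ, |ε| ≤ 1 ∧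
      GammaField i = fun u z => z a * pd b u z + ε * (z b * pd a u z) := by
  fin_cases i
  · exact .inl ⟨0, rfl⟩
  · exact .inl ⟨1, rfl⟩
  · exact .inl ⟨2, rfl⟩
  · exact .inl ⟨3, rfl⟩
  · exact .inr ⟨1, 2, -1, by simp, by funext u z; simp [GammaField, sub_eq_add_neg]⟩
  · exact .inr ⟨1, 3, -1, by simp, by funext u z; simp [GammaField, sub_eq_add_neg]⟩
  · exact .inr ⟨2, 3, -1, by simp, by funext u z; simp [GammaField, sub_eq_add_neg]⟩
  · exact .inr ⟨1, 0, 1, by simp, by funext u z; simp [GammaField]⟩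
  · exact .inr ⟨2, 0, 1, by simp, by funext u z; simp [GammaField]⟩
  · exact .inr ⟨3, 0, 1, by simp, by funext u z; simp [GammaField]⟩

protected lemma ContDiff.GammaField {u : (Fin 4 → ℝ) → ℝ} (hu : ContDiff ℝ (⊤ : ℕ∞) u) (i : Fin 10) :
    ContDiff ℝ (⊤ : ℕ∞) (GammaField i u) := by
  rcases GammaField_eq i with ⟨a, h⟩ | ⟨a, b, ε, -, h⟩
  · rw [h]
    exact hu.pd a
  · have ha := hu.pd a
    have hb := hu.pd b
    rw [h]
    fun_prop

protected lemma HasCompactSupport.GammaField {u : (Fin 4 → ℝ) → ℝ} (hu : HasCompactSupport u)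
    (i : Fin 10) : HasCompactSupport (GammaField i u) := by
  rcases GammaField_eq i with ⟨a, h⟩ | ⟨a, b, ε, -, h⟩
  · rw [h]
    exact hu.pd a
  · rw [h]
    have h1 : HasCompactSupport fun z : Fin 4 → ℝ => z a * pd b u z :=
      (hu.pd b).mul_left (f := fun z : Fin 4 → ℝ => z a)
    have h2 : HasCompactSupport fun z : Fin 4 → ℝ => z b * pd a u z :=
      (hu.pd a).mul_left (f := fun z : Fin 4 → ℝ => z b)
    exact h1.add (h2.mul_left (f := fun _ => ε))

lemma GammaField_add {u v : (Fin 4 → ℝ) → ℝ} (hu : ContDiff ℝ (⊤ : ℕ∞) u)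
    (hv : ContDiff ℝ (⊤ : ℕ∞) v) (i : Fin 10) :
    GammaField i (fun z => u z + v z) = fun z => GammaField i u z + GammaField i v z := by
  rcases GammaField_eq i with ⟨a, h⟩ | ⟨a, b, ε, -, h⟩
  · rw [h, pd_add hu hv]
  · rw [h]
    funext z
    simp only [pd_add hu hv]
    ring

lemma GammaField_const_mul {u : (Fin 4 → ℝ) → ℝ} (hu : ContDiff ℝ (⊤ : ℕ∞) u) (c : ℝ)
    (i : Fin 10) : GammaField i (fun z => c * u z) = fun z => c * GammaField i u z := by
  rcases GammaField_eq i with ⟨a, h⟩ | ⟨a, b, ε, -, h⟩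
  · rw [h, pd_const_mul hu]
  · rw [h]
    funext z
    simp only [pd_const_mul hu]
    ring

protected lemma ContDiff.opIter_GammaField {u : (Fin 4 → ℝ) → ℝ} (hu : ContDiff ℝ (⊤ : ℕ∞) u)
    (L : List (Fin 10)) : ContDiff ℝ (⊤ : ℕ∞) (opIter GammaField L u) := by
  induction L with
  | nil => exact hu
  | cons i L ih => exact ih.GammaField i

protected lemma HasCompactSupport.opIter_GammaField {u : (Fin 4 → ℝ) → ℝ} (hu : HasCompactSupport u)
    (L : List (Fin 10)) : HasCompactSupport (opIter GammaField L u) := by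
  induction L with
  | nil => exact hu
  | cons i L ih => exact ih.GammaField i

lemma opIter_append {α γ : Type*} (F : α → γ → γ) (L M : List α) (u : γ) :
    opIter F (L ++ M) u = opIter F L (opIter F M u) := by
  induction L with
  | nil => rfl
  | cons i L ih => simp only [List.cons_append, opIter, ih]

lemma opIter_GammaField_add {u v : (Fin 4 → ℝ) → ℝ} (hu : ContDiff ℝ (⊤ : ℕ∞) u)
    (hv : ContDiff ℝ (⊤ : ℕ∞) v) (L : List (Fin 10)) :
    opIter GammaField L (fun z => u z + v z) =
      fun z => opIter GammaField L u z + opIter GammaField L v z := by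
  induction L with
  | nil => rfl
  | cons i L ih =>
    simp only [opIter]
    rw [ih, GammaField_add (hu.opIter_GammaField L) (hv.opIter_GammaField L)]

lemma opIter_GammaField_const_mul {u : (Fin 4 → ℝ) → ℝ} (hu : ContDiff ℝ (⊤ : ℕ∞) u) (c : ℝ)
    (L : List (Fin 10)) :
    opIter GammaField L (fun z => c * u z) = fun z => c * opIter GammaField L u z := by
  induction L with
  | nil => rfl
  | cons i L ih =>
    simp only [opIter]
    rw [ih, GammaField_const_mul (hu.opIter_GammaField L)]

/-- The commutator of a coordinate derivative with a vector field is a combination of at most two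
coordinate derivatives, with coefficients bounded by one. -/
lemma pd_GammaField (i : Fin 10) (j : Fin 4) :
    ∃ a b : Fin 4, ∃ c d : ℝ, |c| ≤ 1 ∧ |d| ≤ 1 ∧ ∀ u : (Fin 4 → ℝ) → ℝ,
      ContDiff ℝ (⊤ : ℕ∞) u →
        pd j (GammaField i u) =
          fun z => GammaField i (pd j u) z + (c * pd b u z + d * pd a u z) := by
  have hs : ∀ a : Fin 4, |(Pi.single j (1 : ℝ) : Fin 4 → ℝ) a| ≤ 1 := by
    intro a
    rcases eq_or_ne a j with rfl | h
    · simp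
    · simp [h]
  rcases GammaField_eq i with ⟨a, h⟩ | ⟨a, b, ε, hε, h⟩
  · refine ⟨0, 0, 0, 0, by simp, by simp, fun u hu => ?_⟩
    rw [h, pd_comm hu]
    simp
  · refine ⟨a, b, (Pi.single j (1 : ℝ) : Fin 4 → ℝ) a, ε * (Pi.single j (1 : ℝ) : Fin 4 → ℝ) b,
      hs a, abs_mul_le_of_abs_le_one hε (hs b), fun u hu => ?_⟩
    have ha := hu.pd a
    have hb := hu.pd b
    rw [h]
    rw [pd_add (by fun_prop) (by fun_prop), pd_const_mul (by fun_prop), pd_coord_mul hb,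
      pd_coord_mul ha, pd_comm hu j a, pd_comm hu j b]
    funext z
    ring

/-- The pointwise size of `Γ^M ∂ Γ^L w`. -/
def gradSize (w : (Fin 4 → ℝ) → ℝ) (M L : List (Fin 10)) (z : Fin 4 → ℝ) : ℝ :=
  ∑ j : Fin 4, |opIter GammaField M (pd j (opIter GammaField L w)) z|

/-- The pointwise size of all `Γ^β ∂ w` with `|β| < N`. -/
def gradSum (w : (Fin 4 → ℝ) → ℝ) (N : ℕ) (z : Fin 4 → ℝ) : ℝ :=
  ∑ n ∈ Finset.range N, ∑ σ : Fin n → Fin 10, ∑ j : Fin 4,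
    |opIter GammaField (List.ofFn σ) (pd j w) z|

lemma le_gradSize (w : (Fin 4 → ℝ) → ℝ) (M L : List (Fin 10)) (z : Fin 4 → ℝ) (j : Fin 4) :
    |opIter GammaField M (pd j (opIter GammaField L w)) z| ≤ gradSize w M L z :=
  Finset.single_le_sum (f := fun j => |opIter GammaField M (pd j (opIter GammaField L w)) z|)
    (fun _ _ => abs_nonneg _) (Finset.mem_univ j)

lemma gradSize_cons_le {w : (Fin 4 → ℝ) → ℝ} (hw : ContDiff ℝ (⊤ : ℕ∞) w) (M L : List (Fin 10))
    (i : Fin 10) (z : Fin 4 → ℝ) :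
    gradSize w M (i :: L) z ≤ gradSize w (M ++ [i]) L z + 8 * gradSize w M L z := by
  have hu := hw.opIter_GammaField L
  have step : ∀ j : Fin 4, |opIter GammaField M (pd j (opIter GammaField (i :: L) w)) z| ≤
      |opIter GammaField (M ++ [i]) (pd j (opIter GammaField L w)) z| + 2 * gradSize w M L z := by
    intro j
    obtain ⟨a, b, c, d, hc, hd, h⟩ := pd_GammaField i j
    have ha := hu.pd a
    have hb := hu.pd b
    have hj := (hu.pd j).GammaField i
    simp only [opIter] at *
    rw [h _ hu, opIter_GammaField_add hj (by fun_prop), opIter_GammaField_add (by fun_prop)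
      (by fun_prop), opIter_GammaField_const_mul ha, opIter_GammaField_const_mul hb, opIter_append]
    simp only [opIter, id]
    refine (abs_add_le _ _).trans (add_le_add le_rfl ((abs_add_le _ _).trans ?_))
    linarith [abs_mul_le_of_abs_le_one hc (le_gradSize w M L z b),
      abs_mul_le_of_abs_le_one hd (le_gradSize w M L z a)]
  refine (Finset.sum_le_sum fun j _ => step j).trans ?_
  rw [Finset.sum_add_distrib]
  simp only [gradSize, Finset.sum_const, Finset.card_univ, Fintype.card_fin, nsmul_eq_mul]
  push_cast
  linarith

lemma gradSum_mono (w : (Fin 4 → ℝ) → ℝ) (z : Fin 4 → ℝ) : Monotone fun N => gradSum w N z := by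
  intro N N' h
  exact Finset.sum_le_sum_of_subset_of_nonneg (Finset.range_mono h) fun _ _ _ => by positivity

lemma gradSize_nil_le (w : (Fin 4 → ℝ) → ℝ) (M : List (Fin 10)) (z : Fin 4 → ℝ) :
    gradSize w M [] z ≤ gradSum w (M.length + 1) z := by
  have h1 := Finset.single_le_sum (f := fun n => ∑ σ : Fin n → Fin 10, ∑ j : Fin 4,
    |opIter GammaField (List.ofFn σ) (pd j w) z|) (fun _ _ => by positivity)
    (Finset.self_mem_range_succ M.length)
  have h2 := Finset.single_le_sum (f := fun σ : Fin M.length → Fin 10 => ∑ j : Fin 4,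
    |opIter GammaField (List.ofFn σ) (pd j w) z|) (fun _ _ => by positivity)
    (Finset.mem_univ M.get)
  rw [List.ofFn_get] at h2
  exact h2.trans h1

/-- Commuting the derivative to the right of all vector fields. -/
lemma gradSize_le_gradSum {w : (Fin 4 → ℝ) → ℝ} (hw : ContDiff ℝ (⊤ : ℕ∞) w)
    (L M : List (Fin 10)) (z : Fin 4 → ℝ) :
    gradSize w M L z ≤ 9 ^ L.length * gradSum w (M.length + L.length + 1) z := by
  induction L generalizing M with
  | nil => simpa using gradSize_nil_le w M z
  | cons i L ih =>
    have h1 := ih (M ++ [i])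
    have h2 := (ih M).trans (mul_le_mul_of_nonneg_left
      (gradSum_mono w z (Nat.le_succ (M.length + L.length + 1))) (by positivity))
    have e : (M ++ [i]).length + L.length + 1 = M.length + (L.length + 1) + 1 := by
      simp; omega
    rw [e] at h1
    refine (gradSize_cons_le hw M L i z).trans ?_
    simp only [List.length_cons, pow_succ]
    simp only [Nat.succ_eq_add_one, add_assoc] at h1 h2 ⊢
    linarith

lemma rad_nonneg (z : Fin 4 → ℝ) : 0 ≤ rad z := Real.sqrt_nonneg _

lemma continuous_rad : Continuous rad := by
  unfold rad
  fun_prop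

lemma sqrt_one_add_sq_le (a : ℝ) : Real.sqrt (1 + a ^ 2) ≤ 1 + |a| := by
  rw [Real.sqrt_le_left (by positivity)]
  nlinarith [abs_nonneg a, sq_abs a]

lemma le_sqrt_one_add_sq (a : ℝ) : a ≤ Real.sqrt (1 + a ^ 2) :=
  Real.le_sqrt_of_sq_le (by linarith)

/-- The pointwise estimate behind the theorem. -/
lemma pointwise_bound {w : (Fin 4 → ℝ) → ℝ} (hw : ContDiff ℝ (⊤ : ℕ∞) w) (L : List (Fin 10))
    {z : Fin 4 → ℝ} (hz : 0 ≤ z 0) (i j : Fin 4) :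
    |Real.sqrt (1 + (z 0 - rad z) ^ 2) * pd i (pd j (opIter GammaField L w)) z| ≤
      34 * 9 ^ L.length * gradSum w (L.length + 2) z +
        |Real.sqrt (1 + (z 0 + rad z) ^ 2) * Box (opIter GammaField L w) z| := by
  have hu := hw.opIter_GammaField L
  set u := opIter GammaField L w
  set A := 9 ^ L.length * gradSum w (L.length + 2) z
  have hG : ∀ (k : Fin 10) (j : Fin 4), |GammaField k (pd j u) z| ≤ A := by
    intro k j
    have := (le_gradSize w [k] L z j).trans (gradSize_le_gradSum hw L [k] z)
    rwa [show [k].length + L.length + 1 = L.length + 2 by simp; omega] at this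
  have hA0 : 0 ≤ A := (abs_nonneg _).trans (hG 0 0)
  have hpd : ∀ i j : Fin 4, |pd i (pd j u) z| ≤ A := by
    intro i j
    fin_cases i
    · exact hG 0 j
    · exact hG 1 j
    · exact hG 2 j
    · exact hG 3 j
  have key := hessian_bound (H := fun i j => pd i (pd j u) z) (x := fun k => z k.succ)
    (t := z 0) (r := rad z) (A := A) (fun i j => congrFun (pd_comm hu i j) z) hz (rad_nonneg z)
    (by
      rw [rad, Real.sq_sqrt (by positivity), Fin.sum_univ_three]
      rfl)
    (fun k i => by
      fin_cases k
      · exact hG 7 i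
      · exact hG 8 i
      · exact hG 9 i)
    (fun j k i => by
      fin_cases j <;> fin_cases k
      · simpa using hA0
      · exact hG 4 i
      · exact hG 5 i
      · rw [abs_sub_comm]; exact hG 4 i
      · simpa using hA0
      · exact hG 6 i
      · rw [abs_sub_comm]; exact hG 5 i
      · rw [abs_sub_comm]; exact hG 6 i
      · simpa using hA0) i j
  have hbox : pd 0 (pd 0 u) z - ∑ k : Fin 3, pd k.succ (pd k.succ u) z = Box u z := by
    simp only [Fin.sum_univ_three, Box]
    have : Fin.succ (2 : Fin 3) = 3 := rfl
    simp only [Fin.succ_zero_eq_one, Fin.succ_one_eq_two, this]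
    ring
  simp only [hbox] at key
  rw [abs_mul, abs_mul, abs_of_nonneg (Real.sqrt_nonneg _), abs_of_nonneg (Real.sqrt_nonneg _)]
  have h1 := mul_le_mul_of_nonneg_right (sqrt_one_add_sq_le (z 0 - rad z))
    (abs_nonneg (pd i (pd j u) z))
  have h2 := mul_le_mul_of_nonneg_right (le_sqrt_one_add_sq (z 0 + rad z))
    (abs_nonneg (Box u z))
  have h3 := hpd i j
  linarith

lemma L2x_nonneg (f : (Fin 4 → ℝ) → ℝ) (t : ℝ) : 0 ≤ L2x f t := Real.sqrt_nonneg _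

lemma L2x_abs (f : (Fin 4 → ℝ) → ℝ) (t : ℝ) : L2x (fun z => |f z|) t = L2x f t := by
  simp [L2x]

lemma L2x_const_mul (f : (Fin 4 → ℝ) → ℝ) {c : ℝ} (hc : 0 ≤ c) (t : ℝ) :
    L2x (fun z => c * f z) t = c * L2x f t := by
  simp only [L2x, mul_pow, integral_const_mul]
  rw [Real.sqrt_mul (sq_nonneg c), Real.sqrt_sq hc]

lemma memLp_slice {f : (Fin 4 → ℝ) → ℝ} (hf : Continuous f) (hf' : HasCompactSupport f) (t : ℝ) :
    MemLp (fun x : Fin 3 → ℝ => f (Fin.cons t x)) 2 := by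
  have hc : Continuous fun x : Fin 3 → ℝ => f (Fin.cons t x) :=
    hf.comp (continuous_const.finCons continuous_id)
  refine hc.memLp_of_hasCompactSupport ?_
  have htail : Continuous fun z : Fin 4 → ℝ => (Fin.tail z : Fin 3 → ℝ) :=
    continuous_pi fun i => continuous_apply _
  refine HasCompactSupport.intro (hf'.isCompact.image htail) fun x hx => ?_
  by_contra hne
  exact hx ⟨Fin.cons t x, subset_tsupport f hne, Fin.tail_cons _ _⟩

lemma L2x_eq_lpNorm {f : (Fin 4 → ℝ) → ℝ} {t : ℝ}
    (hf : MemLp (fun x : Fin 3 → ℝ => f (Fin.cons t x)) 2) :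
    L2x f t = lpNorm (fun x : Fin 3 → ℝ => f (Fin.cons t x)) 2 volume := by
  rw [lpNorm_eq_integral_norm_rpow_toReal (by simp) (by simp) hf.aestronglyMeasurable, L2x,
    Real.sqrt_eq_rpow]
  simp

lemma L2x_mono {f g : (Fin 4 → ℝ) → ℝ} {t : ℝ}
    (hg : MemLp (fun x : Fin 3 → ℝ => g (Fin.cons t x)) 2)
    (h : ∀ x : Fin 3 → ℝ, |f (Fin.cons t x)| ≤ g (Fin.cons t x)) : L2x f t ≤ L2x g t := by
  refine Real.sqrt_le_sqrt (integral_mono_of_nonneg (.of_forall fun x => sq_nonneg _)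
    hg.integrable_sq (.of_forall fun x => ?_))
  simpa only [sq_abs] using pow_le_pow_left₀ (abs_nonneg _) (h x) 2

lemma L2x_add_le {f g : (Fin 4 → ℝ) → ℝ} {t : ℝ}
    (hf : MemLp (fun x : Fin 3 → ℝ => f (Fin.cons t x)) 2)
    (hg : MemLp (fun x : Fin 3 → ℝ => g (Fin.cons t x)) 2) :
    L2x (fun z => f z + g z) t ≤ L2x f t + L2x g t := by
  rw [L2x_eq_lpNorm hf, L2x_eq_lpNorm hg, L2x_eq_lpNorm (hf.add hg)]
  exact lpNorm_add_le hf (by norm_num)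

lemma L2x_sum_le {ι : Type*} (s : Finset ι) {f : ι → (Fin 4 → ℝ) → ℝ} {t : ℝ}
    (hf : ∀ k ∈ s, MemLp (fun x : Fin 3 → ℝ => f k (Fin.cons t x)) 2) :
    L2x (fun z => ∑ k ∈ s, f k z) t ≤ ∑ k ∈ s, L2x (f k) t := by
  rw [L2x_eq_lpNorm (memLp_finsetSum s hf),
    Finset.sum_congr rfl fun k hk => L2x_eq_lpNorm (hf k hk)]
  simpa only [Finset.sum_fn] using lpNorm_sum_le hf (by norm_num)

lemma memLp_gradSum_summand {w : (Fin 4 → ℝ) → ℝ} (hw : ContDiff ℝ (⊤ : ℕ∞) w)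
    (hw' : HasCompactSupport w) (M : List (Fin 10)) (j : Fin 4) (t : ℝ) :
    MemLp (fun x : Fin 3 → ℝ => |opIter GammaField M (pd j w) (Fin.cons t x)|) 2 :=
  (memLp_slice ((hw.pd j).opIter_GammaField M).continuous
    ((hw'.pd j).opIter_GammaField M) t).abs

lemma memLp_gradSum {w : (Fin 4 → ℝ) → ℝ} (hw : ContDiff ℝ (⊤ : ℕ∞) w)
    (hw' : HasCompactSupport w) (N : ℕ) (t : ℝ) :
    MemLp (fun x : Fin 3 → ℝ => gradSum w N (Fin.cons t x)) 2 :=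
  memLp_finsetSum _ fun _ _ => memLp_finsetSum _ fun _ _ => memLp_finsetSum _ fun j _ =>
    memLp_gradSum_summand hw hw' _ j t

lemma L2x_gradSum_le {w : (Fin 4 → ℝ) → ℝ} (hw : ContDiff ℝ (⊤ : ℕ∞) w)
    (hw' : HasCompactSupport w) (N : ℕ) (t : ℝ) :
    L2x (gradSum w N) t ≤ ∑ n ∈ Finset.range N, ∑ σ : Fin n → Fin 10, ∑ j : Fin 4,
      L2x (opIter GammaField (List.ofFn σ) (pd j w)) t := by
  have hm := fun M j => memLp_gradSum_summand hw hw' M j t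
  refine (L2x_sum_le _ (f := fun n z => ∑ σ : Fin n → Fin 10, ∑ j : Fin 4,
    |opIter GammaField (List.ofFn σ) (pd j w) z|) fun _ _ => memLp_finsetSum _ fun _ _ =>
    memLp_finsetSum _ fun _ _ => hm _ _).trans (Finset.sum_le_sum fun n _ => ?_)
  refine (L2x_sum_le _ (f := fun (σ : Fin n → Fin 10) z => ∑ j : Fin 4,
    |opIter GammaField (List.ofFn σ) (pd j w) z|) fun _ _ =>
    memLp_finsetSum _ fun _ _ => hm _ _).trans (Finset.sum_le_sum fun σ _ => ?_)
  refine (L2x_sum_le _ (f := fun j z => |opIter GammaField (List.ofFn σ) (pd j w) z|)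
    fun _ _ => hm _ _).trans (Finset.sum_le_sum fun j _ => ?_)
  rw [L2x_abs]

lemma memLp_weighted_Box {u : (Fin 4 → ℝ) → ℝ} (hu : ContDiff ℝ (⊤ : ℕ∞) u)
    (hu' : HasCompactSupport u) (t : ℝ) :
    MemLp (fun x : Fin 3 → ℝ => (fun z => Real.sqrt (1 + (z 0 + rad z) ^ 2) * Box u z)
      (Fin.cons t x)) 2 := by
  have hc : ∀ i : Fin 4, Continuous (pd i (pd i u)) := fun i => ((hu.pd i).pd i).continuous
  have hs : ∀ i : Fin 4, HasCompactSupport (pd i (pd i u)) := fun i => (hu'.pd i).pd i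
  have hB : Continuous (Box u) := (((hc 0).sub (hc 1)).sub (hc 2)).sub (hc 3)
  have hB' : HasCompactSupport (Box u) := (((hs 0).sub (hs 1)).sub (hs 2)).sub (hs 3)
  have hr := continuous_rad
  exact memLp_slice (f := fun z => Real.sqrt (1 + (z 0 + rad z) ^ 2) * Box u z) (by fun_prop)
    (hB'.mul_left (f := fun z : Fin 4 → ℝ => Real.sqrt (1 + (z 0 + rad z) ^ 2))) t

/-- Klainerman–Sideris type `L²` estimate: for every multi-index length `m`
there is a constant `C` such that for every `w ∈ C₀^∞(ℝ₊×ℝ³)`, every product `Γ^α` of `|α| ≤ m`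
vector fields from `Γ` and every `t ≥ 0`,
`‖⟨t-r⟩ ∂²_{t,x} Γ^α w(t,·)‖₂ ≤ C Σ_{|β|≤|α|+1} ‖Γ^β ∂w(t,·)‖₂ + C Σ_{|β|≤|α|} ‖⟨t+r⟩ □Γ^β w(t,·)‖₂`. -/
theorem stmt9 (m : ℕ) :
    ∃ C : ℝ, 0 < C ∧
      ∀ w : (Fin 4 → ℝ) → ℝ, ContDiff ℝ (⊤ : ℕ∞) w → HasCompactSupport w →
        ∀ L : List (Fin 10), L.length ≤ m →
          ∀ t : ℝ, 0 ≤ t →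
            (∑ i : Fin 4, ∑ j : Fin 4,
                L2x (fun z => Real.sqrt (1 + (z 0 - rad z)^2) *
                  pd i (pd j (opIter GammaField L w)) z) t) ≤
              C * (∑ n ∈ Finset.range (L.length + 2), ∑ σ : Fin n → Fin 10, ∑ j : Fin 4,
                    L2x (opIter GammaField (List.ofFn σ) (pd j w)) t) +
              C * (∑ n ∈ Finset.range (L.length + 1), ∑ σ : Fin n → Fin 10,
                    L2x (fun z => Real.sqrt (1 + (z 0 + rad z)^2) *
                      Box (opIter GammaField (List.ofFn σ) w) z) t) := by
  refine ⟨16 * (34 * 9 ^ m), by positivity, fun w hw hw' L hL t ht => ?_⟩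
  set S := ∑ n ∈ Finset.range (L.length + 2), ∑ σ : Fin n → Fin 10, ∑ j : Fin 4,
    L2x (opIter GammaField (List.ofFn σ) (pd j w)) t
  set T := ∑ n ∈ Finset.range (L.length + 1), ∑ σ : Fin n → Fin 10,
    L2x (fun z => Real.sqrt (1 + (z 0 + rad z)^2) *
      Box (opIter GammaField (List.ofFn σ) w) z) t
  have hS0 : 0 ≤ S := Finset.sum_nonneg fun _ _ => Finset.sum_nonneg fun _ _ =>
    Finset.sum_nonneg fun _ _ => L2x_nonneg _ _
  have hT0 : 0 ≤ T := Finset.sum_nonneg fun _ _ => Finset.sum_nonneg fun _ _ => L2x_nonneg _ _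
  have hBox : L2x (fun z => Real.sqrt (1 + (z 0 + rad z)^2) *
      Box (opIter GammaField L w) z) t ≤ T := by
    have h1 := Finset.single_le_sum (f := fun n => ∑ σ : Fin n → Fin 10,
      L2x (fun z => Real.sqrt (1 + (z 0 + rad z)^2) *
        Box (opIter GammaField (List.ofFn σ) w) z) t)
      (fun _ _ => Finset.sum_nonneg fun _ _ => L2x_nonneg _ _)
      (Finset.self_mem_range_succ L.length)
    have h2 := Finset.single_le_sum (f := fun σ : Fin L.length → Fin 10 =>
      L2x (fun z => Real.sqrt (1 + (z 0 + rad z)^2) *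
        Box (opIter GammaField (List.ofFn σ) w) z) t)
      (fun _ _ => L2x_nonneg _ _) (Finset.mem_univ L.get)
    rw [List.ofFn_get] at h2
    exact h2.trans h1
  have hpow : (9 : ℝ) ^ L.length ≤ 9 ^ m := pow_le_pow_right₀ (by norm_num) hL
  have hone : (1 : ℝ) ≤ 9 ^ m := one_le_pow₀ (by norm_num)
  have hterm : ∀ i j : Fin 4, L2x (fun z => Real.sqrt (1 + (z 0 - rad z)^2) *
      pd i (pd j (opIter GammaField L w)) z) t ≤ 34 * 9 ^ m * (S + T) := by
    intro i j
    have hm1 := (memLp_gradSum hw hw' (L.length + 2) t).const_mul (34 * 9 ^ L.length)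
    have hm2 := (memLp_weighted_Box (hw.opIter_GammaField L) (hw'.opIter_GammaField L) t).abs
    refine (L2x_mono (g := fun z => 34 * 9 ^ L.length * gradSum w (L.length + 2) z +
      |Real.sqrt (1 + (z 0 + rad z)^2) * Box (opIter GammaField L w) z|) (hm1.add hm2) fun x =>
      pointwise_bound hw L (z := Fin.cons t x) (by simpa using ht) i j).trans ?_
    refine (L2x_add_le (f := fun z => 34 * 9 ^ L.length * gradSum w (L.length + 2) z)
      (g := fun z => |Real.sqrt (1 + (z 0 + rad z)^2) * Box (opIter GammaField L w) z|)
      hm1 hm2).trans ?_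
    rw [L2x_const_mul _ (by positivity), L2x_abs]
    have h1 : 34 * 9 ^ L.length * L2x (gradSum w (L.length + 2)) t ≤ 34 * 9 ^ m * S :=
      mul_le_mul (by linarith) (L2x_gradSum_le hw hw' _ t) (L2x_nonneg _ _) (by positivity)
    nlinarith
  refine (Finset.sum_le_sum fun i _ => Finset.sum_le_sum fun j _ => hterm i j).trans ?_
  simp only [Finset.sum_const, Finset.card_univ, Fintype.card_fin, nsmul_eq_mul]
  push_cast
  linarith
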